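/- arXiv:1910.05651 — 2 statements merged into one kernel-verified Lean document; each statement's English description precedes it below -/
import Mathlib

section
/- Let T be a finite tree with vertex set V of cardinality n, let X ∈ V, and let I ⊆ V. If X ∈ I, then D(I, T^X) = n − 1. If X ∉ I and X lies in the component C_j(I) of the induced subgraph of T on V∖I, then D(I, T^X) = n − |C_j(I)|. -/
/-- In the `X`-rooted orientation of the tree `T`, the edge `{u,v}` is directed as `u → v`
exactly when `u` and `v` are adjacent and `u` lies on the (unique) path in `T` from `X` to
`v` (all edges point away from the root `X`). -/
def rootedDir {V : Type*} (T : SimpleGraph V) (X u v : V) : Prop :=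
  T.Adj u v ∧ ∀ p : T.Path X v, u ∈ p.val.support

/-- The `X`-rooted and `Y`-rooted orientations of `T` assign the same direction to the
edge `e`. -/
def agreesOn {V : Type*} (T : SimpleGraph V) (X Y : V) (e : Sym2 V) : Prop :=
  ∀ u v : V, e = s(u, v) → (rootedDir T X u v ↔ rootedDir T Y u v)

/-- An edge `e` of `T` is *identified* by the target set `I` with respect to the root `X` if
every vertex `Y` whose rooted orientation `T^Y` assigns the same direction as `T^X` to every
edge incident to a vertex of `I` also assigns the same direction as `T^X` to `e`. -/
def identified {V : Type*} (T : SimpleGraph V) (X : V) (I : Set V) (e : Sym2 V) : Prop :=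
  e ∈ T.edgeSet ∧
    ∀ Y : V, (∀ e' ∈ T.edgeSet, (∃ x ∈ I, x ∈ e') → agreesOn T X Y e') → agreesOn T X Y e

/-- The gain `D(I, T^X)`: the number of edges of `T` identified by `I` with respect to the
root `X`. -/
noncomputable def gain {V : Type*} (T : SimpleGraph V) (X : V) (I : Set V) : ℕ :=
  {e | identified T X I e}.ncard

/-- `Desc_X(w)`: the set of vertices `v` such that `w` lies on the unique path from `X`
to `v`. -/
def desc {V : Type*} (T : SimpleGraph V) (X w : V) : Set V :=
  {v | ∀ p : T.Path X v, w ∈ p.val.support}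

/-- The vertex set of the connected component containing `y` of the subgraph of `T` induced
on the complement of `I`. -/
def comp {V : Type*} (T : SimpleGraph V) (I : Set V) (y : V) : Set V :=
  {z | ∃ p : T.Walk y z, ∀ u ∈ p.support, u ∉ I}

section Descendants

variable {V : Type*} {T : SimpleGraph V} {X Y u v w : V}

open SimpleGraph

theorem mem_desc_iff_forall_walk : v ∈ desc T X w ↔ ∀ p : T.Walk X v, w ∈ p.support := by
  classical
  exact ⟨fun h p => p.support_bypass_subset_support (h ⟨p.bypass, p.bypass_isPath⟩),
    fun h p => h p.val⟩

theorem mem_desc_trans (hv : v ∈ desc T X w) (hY : Y ∈ desc T X v) : Y ∈ desc T X w := by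
  classical
  rw [mem_desc_iff_forall_walk] at *
  intro p
  exact p.support_takeUntil_subset_support (hY p) (hv (p.takeUntil v (hY p)))

theorem mem_desc_self : v ∈ desc T X v := fun p => p.val.end_mem_support

theorem SimpleGraph.IsAcyclic.mem_desc_iff (hT : T.IsAcyclic) {p : T.Walk X v} (hp : p.IsPath) :
    v ∈ desc T X w ↔ w ∈ p.support := by
  refine ⟨fun h => h ⟨p, hp⟩, fun h q => ?_⟩
  rwa [(hT.subsingleton_path X v).elim q ⟨p, hp⟩]

theorem SimpleGraph.IsTree.exists_isPath (hT : T.IsTree) (X v : V) :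
    ∃ p : T.Walk X v, p.IsPath :=
  (hT.existsUnique_path X v).exists

theorem SimpleGraph.IsTree.not_rootedDir_iff (hT : T.IsTree) (h : T.Adj u v) :
    ¬ rootedDir T X u v ↔ rootedDir T X v u := by
  classical
  obtain ⟨p, hp⟩ := hT.exists_isPath X v
  have key : v ∈ desc T X u ↔ u ∈ p.support := hT.isAcyclic.mem_desc_iff hp
  constructor
  · intro hn
    have hu : u ∉ p.support := fun hu => hn ⟨h, key.2 hu⟩
    refine ⟨h.symm, (hT.isAcyclic.mem_desc_iff (hp.concat hu h.symm)).2 ?_⟩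
    simp [Walk.support_concat]
  · rintro ⟨-, hu⟩ ⟨-, hv⟩
    have hup := key.1 hv
    exact Walk.endpoint_notMem_support_takeUntil hp hup h.ne' (hu ⟨_, hp.takeUntil hup⟩)

theorem SimpleGraph.IsTree.rootedDir_left_unique (hT : T.IsTree) (hu : rootedDir T X u v)
    (hw : rootedDir T X w v) : u = w := by
  classical
  obtain ⟨p, hp⟩ := hT.exists_isPath X v
  have key : ∀ {x}, rootedDir T X x v → p.penultimate = x := by
    intro x hx
    have hxp := hx.2 ⟨p, hp⟩
    have hc := (hp.takeUntil hxp).concat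
      (Walk.endpoint_notMem_support_takeUntil hp hxp hx.1.ne') hx.1
    have := congrArg Subtype.val ((hT.isAcyclic.subsingleton_path X v).elim ⟨p, hp⟩ ⟨_, hc⟩)
    rw [show p = _ from this, Walk.penultimate_concat]
  rw [← key hu, key hw]

theorem SimpleGraph.IsTree.exists_rootedDir (hT : T.IsTree) (hv : v ≠ X) :
    ∃ u, rootedDir T X u v := by
  obtain ⟨p, hp⟩ := hT.exists_isPath X v
  exact ⟨p.penultimate, p.adj_penultimate (Walk.not_nil_of_ne hv.symm),
    (hT.isAcyclic.mem_desc_iff hp).2 (p.getVert_mem_support _)⟩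

theorem ne_root_of_rootedDir (h : rootedDir T X u v) : v ≠ X := by
  rintro rfl
  have := h.2 Path.nil
  simp only [Path.nil, Walk.support_nil, List.mem_singleton] at this
  exact h.1.ne this

theorem SimpleGraph.IsTree.not_agreesOn_iff (hT : T.IsTree) (h : rootedDir T X u v) :
    ¬ agreesOn T X Y s(u, v) ↔ Y ∈ desc T X v := by
  classical
  have hYX : agreesOn T X Y s(u, v) ↔ rootedDir T Y u v := by
    refine ⟨fun ha => (ha u v rfl).1 h, fun hY a b hab => ?_⟩
    rcases Sym2.eq_iff.1 hab with ⟨rfl, rfl⟩ | ⟨rfl, rfl⟩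
    · exact iff_of_true h hY
    · exact iff_of_false (fun h' => (hT.not_rootedDir_iff h.1).2 h' h)
        (fun h' => (hT.not_rootedDir_iff h.1).2 h' hY)
  obtain ⟨R, hR⟩ := hT.exists_isPath X Y
  rw [hYX, hT.isAcyclic.mem_desc_iff hR]
  constructor
  · intro hn
    obtain ⟨N, hN⟩ := hT.exists_isPath Y v
    have huN : u ∉ N.support := fun hu => hn ⟨h.1, (hT.isAcyclic.mem_desc_iff hN).2 hu⟩
    have huR : u ∈ R.support :=
      ((Walk.mem_support_append_iff _ _).1
        (mem_desc_iff_forall_walk.1 h.2 (R.append N))).resolve_right huN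
    have hv := mem_desc_iff_forall_walk.1 ((hT.not_rootedDir_iff h.1).1 hn).2
      (R.dropUntil u huR).reverse
    rw [Walk.support_reverse, List.mem_reverse] at hv
    exact R.support_dropUntil_subset_support huR hv
  · intro hv hY
    have h₁ : u ∈ (R.takeUntil v hv).support := h.2 ⟨_, hR.takeUntil hv⟩
    have h₂ : u ∈ (R.dropUntil v hv).support := by
      have := mem_desc_iff_forall_walk.1 hY.2 (R.dropUntil v hv).reverse
      rwa [Walk.support_reverse, List.mem_reverse] at this
    rw [← R.take_spec hv] at hR
    have hnd := hR.support_nodup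
    rw [Walk.support_append] at hnd
    rw [Walk.mem_support_iff] at h₂
    exact List.disjoint_of_nodup_append hnd h₁ (h₂.resolve_left h.1.ne)

theorem SimpleGraph.IsTree.exists_rootedDir_of_mem_edgeSet (hT : T.IsTree) (X : V) {e : Sym2 V}
    (he : e ∈ T.edgeSet) : ∃ u v, rootedDir T X u v ∧ e = s(u, v) := by
  induction e with
  | _ a b =>
    by_cases h : rootedDir T X a b
    · exact ⟨a, b, h, rfl⟩
    · exact ⟨b, a, (hT.not_rootedDir_iff he).1 h, Sym2.eq_swap⟩

end Descendants

/-- The roots whose orientation of `T` agrees with the `X`-rooted one on all edges incident to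
`I`. -/
def compatibleRoots {V : Type*} (T : SimpleGraph V) (X : V) (I : Set V) : Set V :=
  {Y | ∀ e ∈ T.edgeSet, (∃ x ∈ I, x ∈ e) → agreesOn T X Y e}

section Compatible

variable {V : Type*} {T : SimpleGraph V} {X Y u v : V} {I : Set V}

open SimpleGraph

theorem self_mem_compatibleRoots : X ∈ compatibleRoots T X I :=
  fun _ _ _ _ _ _ => Iff.rfl

theorem SimpleGraph.IsTree.mem_compatibleRoots_iff (hT : T.IsTree) :
    Y ∈ compatibleRoots T X I ↔
      ∀ u v, rootedDir T X u v → (u ∈ I ∨ v ∈ I) → Y ∉ desc T X v := by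
  constructor
  · intro hY u v h hI hd
    refine (hT.not_agreesOn_iff h).2 hd (hY _ h.1 ?_)
    rcases hI with hI | hI
    · exact ⟨u, hI, Sym2.mem_mk_left u v⟩
    · exact ⟨v, hI, Sym2.mem_mk_right u v⟩
  · rintro hY e he ⟨x, hx, hxe⟩
    obtain ⟨u, v, h, rfl⟩ := hT.exists_rootedDir_of_mem_edgeSet X he
    by_contra hn
    refine hY u v h ?_ ((hT.not_agreesOn_iff h).1 hn)
    rcases Sym2.mem_iff.1 hxe with rfl | rfl
    · exact .inl hx
    · exact .inr hx

theorem SimpleGraph.IsTree.identified_iff (hT : T.IsTree) (h : rootedDir T X u v) :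
    identified T X I s(u, v) ↔ v ∉ compatibleRoots T X I := by
  constructor
  · intro hi hv
    exact (hT.not_agreesOn_iff h).2 mem_desc_self (hi.2 v hv)
  · refine fun hv => ⟨h.1, fun Y hY => ?_⟩
    by_contra hn
    have hd := (hT.not_agreesOn_iff h).1 hn
    refine hv (hT.mem_compatibleRoots_iff.2 fun a b hab hI hvb => ?_)
    exact hT.mem_compatibleRoots_iff.1 hY a b hab hI (mem_desc_trans hvb hd)

theorem SimpleGraph.IsTree.gain_eq_ncard_compl (hT : T.IsTree) :
    gain T X I = (compatibleRoots T X I)ᶜ.ncard := by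
  have hne : ∀ v ∈ (compatibleRoots T X I)ᶜ, v ≠ X := by
    rintro v hv rfl
    exact hv self_mem_compatibleRoots
  choose! par hpar using fun v (hv : v ≠ X) => hT.exists_rootedDir hv
  have himg : {e | identified T X I e} =
      (fun v => s(par v, v)) '' (compatibleRoots T X I)ᶜ := by
    ext e
    constructor
    · intro he
      obtain ⟨u, v, h, rfl⟩ := hT.exists_rootedDir_of_mem_edgeSet X he.1
      have hu := hT.rootedDir_left_unique (hpar v (ne_root_of_rootedDir h)) h
      exact ⟨v, (hT.identified_iff h).1 he, by simp only [hu]⟩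
    · rintro ⟨v, hv, rfl⟩
      exact (hT.identified_iff (hpar v (hne v hv))).2 hv
  rw [gain, himg, Set.InjOn.ncard_image]
  intro v hv w hw hvw
  rcases Sym2.eq_iff.1 hvw with ⟨-, h⟩ | ⟨h₁, h₂⟩
  · exact h
  · have hv' := hpar v (hne v hv)
    have hw' := hpar w (hne w hw)
    rw [h₁] at hv'
    rw [← h₂] at hw'
    exact absurd hv' ((hT.not_rootedDir_iff hw'.1.symm).2 hw')

theorem SimpleGraph.IsTree.compatibleRoots_of_mem (hT : T.IsTree) (hX : X ∈ I) :
    compatibleRoots T X I = {X} := by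
  refine Set.eq_singleton_iff_unique_mem.2 ⟨self_mem_compatibleRoots, fun Y hY => ?_⟩
  by_contra hne
  obtain ⟨p, hp⟩ := hT.exists_isPath X Y
  have hnil : ¬ p.Nil := Walk.not_nil_of_ne (Ne.symm hne)
  have hadj := p.adj_snd hnil
  refine hT.mem_compatibleRoots_iff.1 hY X p.snd ⟨hadj, fun q => q.val.start_mem_support⟩
    (.inl hX) ((hT.isAcyclic.mem_desc_iff hp).2 ?_)
  exact p.getVert_mem_support 1

theorem SimpleGraph.IsTree.compatibleRoots_of_notMem (hT : T.IsTree) (hX : X ∉ I) :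
    compatibleRoots T X I = comp T I X := by
  ext Y
  rw [hT.mem_compatibleRoots_iff]
  constructor
  · intro hY
    obtain ⟨p, hp⟩ := hT.exists_isPath X Y
    refine ⟨p, fun z hz hzI => ?_⟩
    obtain ⟨u, hu⟩ := hT.exists_rootedDir (ne_of_mem_of_not_mem hzI hX)
    exact hY u z hu (.inr hzI) ((hT.isAcyclic.mem_desc_iff hp).2 hz)
  · rintro ⟨p, hp⟩ u v h hI hd
    rcases hI with hI | hI
    · exact hp u (mem_desc_iff_forall_walk.1 (mem_desc_trans h.2 hd) p) hI
    · exact hp v (mem_desc_iff_forall_walk.1 hd p) hI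

end Compatible

/-- **Lemma 6**: For a finite tree `T` of order `n` rooted at `X` and a target set `I`:
if `X ∈ I` then the gain is `n - 1`; if `X ∉ I` and `X` lies in the component `C_j(I)` of the
subgraph induced on the complement of `I`, then the gain is `n - |C_j(I)|`. -/
theorem gain_tree_formula
    {V : Type*} [Fintype V] (T : SimpleGraph V) (hT : T.IsTree) (X : V) (I : Set V) :
    (X ∈ I → gain T X I = Fintype.card V - 1) ∧
    (X ∉ I → gain T X I = Fintype.card V - (comp T I X).ncard) := by
  have hgain : gain T X I = Fintype.card V - (compatibleRoots T X I).ncard := by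
    rw [hT.gain_eq_ncard_compl, Set.ncard_compl, Nat.card_eq_fintype_card]
  refine ⟨fun hX => ?_, fun hX => ?_⟩
  · rw [hgain, hT.compatibleRoots_of_mem hX, Set.ncard_singleton]
  · rw [hgain, hT.compatibleRoots_of_notMem hX]
end

section
/- Let T be a finite tree with vertex set V of cardinality n and let X ∈ V. For any subsets I₁, I₂ ⊆ V, the set of edges of T identified by I₁ ∪ I₂ with respect to root X equals the union of the set of edges identified by I₁ with respect to X and the set of edges identified by I₂ with respect to X. -/
namespace SimpleGraph

variable {V : Type*} {T : SimpleGraph V} {X Y u v : V}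

/-- If deleting the edge `s(u, v)` from `T` separates `X` from `Y`, then any subgraph of `T`
connecting `X` to `Y` connects `X` to `v`. -/
theorem reachable_endpoint_of_not_reachable_deleteEdges
    {H : SimpleGraph V} (hH : H ≤ T)
    (hXY : ¬ (T.deleteEdges {s(u, v)}).Reachable X Y) (h : H.Reachable X Y) :
    H.Reachable X v := by
  classical
  obtain ⟨w⟩ := h
  by_cases hv : v ∈ w.support
  · exact ⟨w.takeUntil v hv⟩
  · refine absurd ⟨(w.mapLe hH).toDeleteEdge s(u, v) fun he => hv ?_⟩ hXY
    simpa using (w.mapLe hH).snd_mem_support_of_mem_edges he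

theorem Connected.reachable_deleteEdges_or (hT : T.Connected) (X u v : V) (huv : u ≠ v) :
    (T.deleteEdges {s(u, v)}).Reachable X u ∨ (T.deleteEdges {s(u, v)}).Reachable X v := by
  classical
  obtain ⟨p, hp⟩ := hT.exists_isPath X u
  by_cases hv : v ∈ p.support
  · refine .inr ⟨(p.takeUntil v hv).toDeleteEdge s(u, v) fun he => ?_⟩
    exact Walk.endpoint_notMem_support_takeUntil hp hv huv
      (Walk.fst_mem_support_of_mem_edges _ he)
  · exact .inl ⟨p.toDeleteEdge s(u, v) fun he => hv (p.snd_mem_support_of_mem_edges he)⟩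

theorem IsAcyclic.not_reachable_deleteEdges (hT : T.IsAcyclic) (huv : T.Adj u v) :
    ¬ (T.deleteEdges {s(u, v)}).Reachable u v :=
  isBridge_iff.mp (isAcyclic_iff_forall_adj_isBridge.mp hT huv)

theorem IsTree.rootedDir_iff (hT : T.IsTree) (huv : T.Adj u v) :
    rootedDir T X u v ↔ (T.deleteEdges {s(u, v)}).Reachable X u := by
  classical
  constructor
  · rintro ⟨-, h⟩
    obtain ⟨p, hp⟩ := hT.connected.exists_isPath X v
    have hu := h ⟨p, hp⟩
    refine ⟨(p.takeUntil u hu).toDeleteEdge s(u, v) fun he => ?_⟩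
    exact Walk.endpoint_notMem_support_takeUntil hp hu huv.ne.symm
      (Walk.snd_mem_support_of_mem_edges _ he)
  · refine fun h => ⟨huv, fun p => ?_⟩
    by_contra hu
    have hXv : (T.deleteEdges {s(u, v)}).Reachable X v :=
      ⟨p.val.toDeleteEdge s(u, v) fun he => hu (p.val.fst_mem_support_of_mem_edges he)⟩
    exact hT.isAcyclic.not_reachable_deleteEdges huv (h.symm.trans hXv)

/-- Two rooted orientations agree on an edge exactly when deleting that edge does not separate
the two roots. -/
theorem IsTree.agreesOn_iff (hT : T.IsTree) {e : Sym2 V} (he : e ∈ T.edgeSet) :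
    agreesOn T X Y e ↔ (T.deleteEdges {e}).Reachable X Y := by
  constructor
  · induction e with | _ u v
    intro h
    have huv : T.Adj u v := he
    have h₁ := h u v rfl
    have h₂ := h v u Sym2.eq_swap
    rw [hT.rootedDir_iff huv, hT.rootedDir_iff huv] at h₁
    rw [hT.rootedDir_iff huv.symm, hT.rootedDir_iff huv.symm, Sym2.eq_swap] at h₂
    obtain hX | hX := hT.connected.reachable_deleteEdges_or X u v huv.ne
    · exact hX.trans (h₁.mp hX).symm
    · exact hX.trans (h₂.mp hX).symm
  · rintro h u v rfl
    have huv : T.Adj u v := he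
    rw [hT.rootedDir_iff huv, hT.rootedDir_iff huv]
    exact ⟨h.symm.trans, h.trans⟩

end SimpleGraph

theorem identified.mono {V : Type*} {T : SimpleGraph V} {X : V} {I J : Set V} {e : Sym2 V}
    (hIJ : I ⊆ J) (h : identified T X I e) : identified T X J e :=
  ⟨h.1, fun Y hY => h.2 Y fun e' he' ⟨x, hx, hxe⟩ => hY e' he' ⟨x, hIJ hx, hxe⟩⟩

/-- **Lemma 7 (tree instance)**: For a finite tree `T` rooted at `X` and any target sets
`I₁, I₂`, the set of edges identified by `I₁ ∪ I₂` equals the union of the sets of edges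
identified by `I₁` and by `I₂`. -/
theorem identified_union
    {V : Type*} [Fintype V] (T : SimpleGraph V) (hT : T.IsTree) (X : V) (I₁ I₂ : Set V) :
    {e | identified T X (I₁ ∪ I₂) e} =
      {e | identified T X I₁ e} ∪ {e | identified T X I₂ e} := by
  ext e
  simp only [Set.mem_ofPred_eq, Set.mem_union]
  refine ⟨fun ⟨he, h⟩ => ?_, ?_⟩
  · by_contra! hne
    simp only [identified, he, true_and, not_forall] at hne
    obtain ⟨⟨Y₁, hY₁, hn₁⟩, ⟨Y₂, hY₂, hn₂⟩⟩ := hne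
    rw [hT.agreesOn_iff he] at hn₁ hn₂
    -- An endpoint of `e` separated from `X` by `e` is a root that refutes `h`.
    obtain ⟨u, v, rfl, hXv⟩ :
        ∃ u v, e = s(u, v) ∧ ¬ (T.deleteEdges {s(u, v)}).Reachable X v := by
      induction e with | _ u v
      have huv := hT.isAcyclic.not_reachable_deleteEdges he
      by_cases hv : (T.deleteEdges {s(u, v)}).Reachable X v
      · refine ⟨v, u, Sym2.eq_swap, fun hu => huv ?_⟩
        rw [Sym2.eq_swap] at hu
        exact hu.symm.trans hv
      · exact ⟨u, v, rfl, hv⟩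
    refine hXv ((hT.agreesOn_iff he).mp (h v ?_))
    rintro e' he' ⟨x, hx | hx, hxe⟩ <;> rw [hT.agreesOn_iff he']
    · exact SimpleGraph.reachable_endpoint_of_not_reachable_deleteEdges (T.deleteEdges_le _) hn₁
        ((hT.agreesOn_iff he').mp (hY₁ e' he' ⟨x, hx, hxe⟩))
    · exact SimpleGraph.reachable_endpoint_of_not_reachable_deleteEdges (T.deleteEdges_le _) hn₂
        ((hT.agreesOn_iff he').mp (hY₂ e' he' ⟨x, hx, hxe⟩))
  · rintro (h | h)
    · exact h.mono Set.subset_union_left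
    · exact h.mono Set.subset_union_right
end
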